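/- arXiv:2605.12664 — 2 statements merged into one kernel-verified Lean document; each statement's English description precedes it below -/
import Mathlib

section
/- Let A be a monotone allocation region, n ≥ 1 an integer, ε = 1/n, and A_ε = φ_ε(A). For 0 ≤ k ≤ n−1 let Δ_k = sup{ q_{A_ε}(v) − q_A(v) : v ∈ ((kε,(k+1)ε] × [0,1]) ∩ A_ε } and for 0 ≤ j ≤ n−1 let Δ'_j = sup{ p_A(v) − p_{A_ε}(v) : v ∈ ([0,1] × (jε,(j+1)ε]) ∩ A_ε }, where the supremum of the empty set is taken to be 0. Then Σ_{k=0}^{n−1} Δ_k ≤ 2 and Σ_{j=0}^{n−1} Δ'_j ≤ 2. -/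
open MeasureTheory Set
open scoped Classical

noncomputable section

/-- The unit square `[0,1]²` of valuation pairs. -/
def square : Set (ℝ × ℝ) := Set.Icc (0:ℝ) 1 ×ˢ Set.Icc (0:ℝ) 1

/-- A (bilateral-trade) monotone allocation region: a closed subset of the unit square,
closed in the north-west direction. -/
def IsAllocRegion (A : Set (ℝ × ℝ)) : Prop :=
  IsClosed A ∧ A ⊆ square ∧
    ∀ x ∈ A, ∀ y ∈ square, y.1 ≤ x.1 → x.2 ≤ y.2 → y ∈ A

/-- Myerson seller payment `p_A`. -/
def sellerPay (A : Set (ℝ × ℝ)) (v : ℝ × ℝ) : ℝ :=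
  if v ∈ A then sSup {x : ℝ | x ∈ Set.Icc (0:ℝ) 1 ∧ (x, v.2) ∈ A} else 0

/-- Myerson buyer payment `q_A`. -/
def buyerPay (A : Set (ℝ × ℝ)) (v : ℝ × ℝ) : ℝ :=
  if v ∈ A then sInf {y : ℝ | y ∈ Set.Icc (0:ℝ) 1 ∧ (v.1, y) ∈ A} else 0

/-- The broker's profit. -/
def profit (A : Set (ℝ × ℝ)) (v : ℝ × ℝ) : ℝ :=
  buyerPay A v - sellerPay A v

/-- The closed `ε`-tile with lower-left corner `(k/n, j/n)`, where `ε = 1/n`. -/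
def tile (n k j : ℕ) : Set (ℝ × ℝ) :=
  Set.Icc ((k : ℝ) / n) (((k : ℝ) + 1) / n) ×ˢ Set.Icc ((j : ℝ) / n) (((j : ℝ) + 1) / n)

/-- The `ε`-approximation `φ_ε(A)`: the union of all `ε`-tiles contained in `A`. -/
def gridApprox (n : ℕ) (A : Set (ℝ × ℝ)) : Set (ℝ × ℝ) :=
  ⋃ (k : Fin n) (j : Fin n) (_ : tile n k j ⊆ A), tile n k j

end

/-- The least buyer value trading with seller value `x`, capped at `1`. -/
noncomputable def buyerThreshold (A : Set (ℝ × ℝ)) (x : ℝ) : ℝ :=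
  sInf (insert 1 {y : ℝ | y ∈ Set.Icc (0:ℝ) 1 ∧ (x, y) ∈ A})

/-- The largest seller value trading with buyer value `y`, or `0` if there is none. -/
noncomputable def sellerThreshold (A : Set (ℝ × ℝ)) (y : ℝ) : ℝ :=
  sSup (insert 0 {x : ℝ | x ∈ Set.Icc (0:ℝ) 1 ∧ (x, y) ∈ A})

lemma buyerThreshold_set_nonneg (A : Set (ℝ × ℝ)) (x : ℝ) :
    ∀ y ∈ insert (1:ℝ) {y : ℝ | y ∈ Set.Icc (0:ℝ) 1 ∧ (x, y) ∈ A}, 0 ≤ y := by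
  rintro y (rfl | hy)
  exacts [zero_le_one, hy.1.1]

lemma sellerThreshold_set_le_one (A : Set (ℝ × ℝ)) (y : ℝ) :
    ∀ x ∈ insert (0:ℝ) {x : ℝ | x ∈ Set.Icc (0:ℝ) 1 ∧ (x, y) ∈ A}, x ≤ 1 := by
  rintro x (rfl | hx)
  exacts [zero_le_one, hx.1.2]

lemma buyerThreshold_mem_Icc (A : Set (ℝ × ℝ)) (x : ℝ) :
    buyerThreshold A x ∈ Set.Icc (0:ℝ) 1 :=
  ⟨le_csInf (insert_nonempty _ _) (buyerThreshold_set_nonneg A x),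
    csInf_le ⟨0, buyerThreshold_set_nonneg A x⟩ (mem_insert _ _)⟩

lemma sellerThreshold_mem_Icc (A : Set (ℝ × ℝ)) (y : ℝ) :
    sellerThreshold A y ∈ Set.Icc (0:ℝ) 1 :=
  ⟨le_csSup ⟨1, sellerThreshold_set_le_one A y⟩ (mem_insert _ _),
    csSup_le (insert_nonempty _ _) (sellerThreshold_set_le_one A y)⟩

lemma buyerThreshold_le (A : Set (ℝ × ℝ)) {x y : ℝ} (hy : y ∈ Set.Icc (0:ℝ) 1)
    (h : (x, y) ∈ A) : buyerThreshold A x ≤ y :=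
  csInf_le ⟨0, buyerThreshold_set_nonneg A x⟩ (mem_insert_of_mem _ ⟨hy, h⟩)

lemma le_sellerThreshold (A : Set (ℝ × ℝ)) {x y : ℝ} (hx : x ∈ Set.Icc (0:ℝ) 1)
    (h : (x, y) ∈ A) : x ≤ sellerThreshold A y :=
  le_csSup ⟨1, sellerThreshold_set_le_one A y⟩ (mem_insert_of_mem _ ⟨hx, h⟩)

lemma le_buyerThreshold {A : Set (ℝ × ℝ)} {x c : ℝ} (hc : c ≤ 1)
    (h : ∀ y ∈ Set.Icc (0:ℝ) 1, (x, y) ∈ A → c ≤ y) : c ≤ buyerThreshold A x := by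
  refine le_csInf (insert_nonempty _ _) ?_
  rintro y (rfl | hy)
  exacts [hc, h y hy.1 hy.2]

lemma sellerThreshold_le {A : Set (ℝ × ℝ)} {y c : ℝ} (hc : 0 ≤ c)
    (h : ∀ x ∈ Set.Icc (0:ℝ) 1, (x, y) ∈ A → x ≤ c) : sellerThreshold A y ≤ c := by
  refine csSup_le (insert_nonempty _ _) ?_
  rintro x (rfl | hx)
  exacts [hc, h x hx.1 hx.2]

lemma IsAllocRegion.buyerThreshold_mono {A : Set (ℝ × ℝ)} (hA : IsAllocRegion A) {x x' : ℝ}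
    (h0 : 0 ≤ x) (hle : x ≤ x') : buyerThreshold A x ≤ buyerThreshold A x' :=
  le_buyerThreshold (buyerThreshold_mem_Icc A x).2 fun _ hy h =>
    buyerThreshold_le A hy
      (hA.2.2 _ h _ ⟨⟨h0, hle.trans (hA.2.1 h).1.2⟩, hy⟩ hle le_rfl)

lemma IsAllocRegion.sellerThreshold_mono {A : Set (ℝ × ℝ)} (hA : IsAllocRegion A) {y y' : ℝ}
    (h1 : y' ≤ 1) (hle : y ≤ y') : sellerThreshold A y ≤ sellerThreshold A y' :=
  sellerThreshold_le (sellerThreshold_mem_Icc A y').1 fun _ hx h =>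
    le_sellerThreshold A hx
      (hA.2.2 _ h _ ⟨hx, (hA.2.1 h).2.1.trans hle, h1⟩ le_rfl hle)

lemma gridApprox_subset (n : ℕ) (A : Set (ℝ × ℝ)) : gridApprox n A ⊆ A := by
  simp only [gridApprox, iUnion_subset_iff]
  exact fun _ _ h => h

/-- A tile lies in the grid approximation as soon as its lower-right corner lies in the region. -/
lemma IsAllocRegion.tile_subset_gridApprox {A : Set (ℝ × ℝ)} (hA : IsAllocRegion A)
    {n k j : ℕ} (hk : k < n) (hj : j < n)
    (h : (((k : ℝ) + 1) / n, (j : ℝ) / n) ∈ A) : tile n k j ⊆ gridApprox n A := by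
  have hn : (0:ℝ) < n := by exact_mod_cast hk.pos
  have hj' : ((j : ℝ) + 1) / n ≤ 1 := by
    rw [div_le_one hn]
    exact_mod_cast hj
  have hsub : tile n k j ⊆ A := by
    rintro ⟨x, y⟩ ⟨hx, hy⟩
    exact hA.2.2 _ h _ ⟨⟨le_trans (by positivity) hx.1, hx.2.trans (hA.2.1 h).1.2⟩,
      ⟨(hA.2.1 h).2.1.trans hy.1, hy.2.trans hj'⟩⟩ hx.2 hy.1
  exact fun v hv => mem_iUnion.2 ⟨⟨k, hk⟩, mem_iUnion.2 ⟨⟨j, hj⟩, mem_iUnion.2 ⟨hsub, hv⟩⟩⟩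

lemma buyerPay_le {A : Set (ℝ × ℝ)} {v : ℝ × ℝ} (hv : v ∈ A) {y : ℝ}
    (hy : y ∈ Set.Icc (0:ℝ) 1) (h : (v.1, y) ∈ A) : buyerPay A v ≤ y := by
  rw [buyerPay, if_pos hv]
  exact csInf_le ⟨0, fun z hz => hz.1.1⟩ ⟨hy, h⟩

lemma le_sellerPay {A : Set (ℝ × ℝ)} {v : ℝ × ℝ} (hv : v ∈ A) {x : ℝ}
    (hx : x ∈ Set.Icc (0:ℝ) 1) (h : (x, v.2) ∈ A) : x ≤ sellerPay A v := by
  rw [sellerPay, if_pos hv]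
  exact le_csSup ⟨1, fun z hz => hz.1.2⟩ ⟨hx, h⟩

lemma IsAllocRegion.buyerThreshold_le_buyerPay {A : Set (ℝ × ℝ)} (hA : IsAllocRegion A)
    {v : ℝ × ℝ} (hv : v ∈ A) {x : ℝ} (h0 : 0 ≤ x) (hx : x ≤ v.1) :
    buyerThreshold A x ≤ buyerPay A v := by
  rw [buyerPay, if_pos hv]
  exact le_csInf ⟨v.2, (hA.2.1 hv).2, hv⟩ fun _ hy =>
    (hA.buyerThreshold_mono h0 hx).trans (buyerThreshold_le A hy.1 hy.2)

lemma IsAllocRegion.sellerPay_le_sellerThreshold {A : Set (ℝ × ℝ)} (hA : IsAllocRegion A)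
    {v : ℝ × ℝ} (hv : v ∈ A) {y : ℝ} (h1 : y ≤ 1) (hy : v.2 ≤ y) :
    sellerPay A v ≤ sellerThreshold A y := by
  rw [sellerPay, if_pos hv]
  exact csSup_le ⟨v.1, (hA.2.1 hv).1, hv⟩ fun _ hx =>
    (le_sellerThreshold A hx.1 hx.2).trans (hA.sellerThreshold_mono h1 hy)

lemma IsAllocRegion.buyerPay_gridApprox_le {A : Set (ℝ × ℝ)} (hA : IsAllocRegion A)
    {n k : ℕ} (hk : k < n) {v : ℝ × ℝ} (hv : v ∈ gridApprox n A)
    (hvk : v.1 ∈ Set.Icc ((k : ℝ) / n) (((k : ℝ) + 1) / n)) :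
    buyerPay (gridApprox n A) v ≤ buyerThreshold A (((k : ℝ) + 1) / n) + 1 / n := by
  have hn : (0:ℝ) < n := by exact_mod_cast hk.pos
  have hε : (0:ℝ) < 1 / n := by positivity
  have hv2 := (hA.2.1 (gridApprox_subset n A hv)).2
  have hpay : buyerPay (gridApprox n A) v ≤ 1 := (buyerPay_le hv hv2 hv).trans hv2.2
  rw [← sub_le_iff_le_add]
  refine le_buyerThreshold (by linarith) fun y hy h => ?_
  rw [sub_le_iff_le_add]
  have hceil : (⌈n * y⌉₊ : ℝ) < n * y + 1 := Nat.ceil_lt_add_one (by have := hy.1; positivity)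
  have hj : (⌈n * y⌉₊ : ℝ) / n ≤ y + 1 / n := by
    rw [div_le_iff₀ hn, add_mul, one_div, inv_mul_cancel₀ hn.ne']
    linarith
  rcases lt_or_ge ⌈n * y⌉₊ n with hlt | hge
  · have hle : (⌈n * y⌉₊ : ℝ) / n ≤ 1 := by
      rw [div_le_one hn]
      exact_mod_cast hlt.le
    have hyj : y ≤ (⌈n * y⌉₊ : ℝ) / n := by
      rw [le_div_iff₀ hn, mul_comm]
      exact Nat.le_ceil _
    have hcorner : (((k : ℝ) + 1) / n, (⌈n * y⌉₊ : ℝ) / n) ∈ A :=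
      hA.2.2 _ h _ ⟨(hA.2.1 h).1, by positivity, hle⟩ le_rfl hyj
    refine (buyerPay_le hv ⟨by positivity, hle⟩
      (hA.tile_subset_gridApprox hk hlt hcorner ⟨hvk, le_rfl, ?_⟩)).trans hj
    dsimp only
    gcongr
    linarith
  · refine hpay.trans (le_trans ?_ hj)
    rw [one_le_div hn]
    exact_mod_cast hge

lemma IsAllocRegion.le_sellerPay_gridApprox {A : Set (ℝ × ℝ)} (hA : IsAllocRegion A)
    {n j : ℕ} (hj : j < n) {v : ℝ × ℝ} (hv : v ∈ gridApprox n A)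
    (hvj : v.2 ∈ Set.Icc ((j : ℝ) / n) (((j : ℝ) + 1) / n)) :
    sellerThreshold A ((j : ℝ) / n) ≤ sellerPay (gridApprox n A) v + 1 / n := by
  have hn : (0:ℝ) < n := by exact_mod_cast hj.pos
  have hε : (0:ℝ) < 1 / n := by positivity
  have hv1 := (hA.2.1 (gridApprox_subset n A hv)).1
  have hpay : 0 ≤ sellerPay (gridApprox n A) v := hv1.1.trans (le_sellerPay hv hv1 hv)
  refine sellerThreshold_le (by linarith) fun x hx h => ?_
  have hnx : (0:ℝ) ≤ n * x := by have := hx.1; positivity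
  have hfloor : n * x < (⌊n * x⌋₊ : ℝ) + 1 := Nat.lt_floor_add_one _
  have hxk : x ≤ (⌊n * x⌋₊ : ℝ) / n + 1 / n := by
    rw [← add_div, le_div_iff₀ hn, mul_comm]
    exact hfloor.le
  have hkx : (⌊n * x⌋₊ : ℝ) / n ≤ x := by
    rw [div_le_iff₀ hn, mul_comm x]
    exact Nat.floor_le hnx
  have hkn : ⌊n * x⌋₊ ≤ n := by
    have : (⌊n * x⌋₊ : ℝ) ≤ n := by
      rw [← div_le_one hn]
      exact hkx.trans hx.2
    exact_mod_cast this
  refine hxk.trans (add_le_add_left ?_ _)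
  generalize ⌊n * x⌋₊ = m at hkx hkn
  rcases m with _ | k
  · simpa using hpay
  · push_cast at hkx ⊢
    have hcorner : (((k : ℝ) + 1) / n, (j : ℝ) / n) ∈ A :=
      hA.2.2 _ h _ ⟨⟨by positivity, hkx.trans hx.2⟩, (hA.2.1 h).2⟩ hkx le_rfl
    refine le_sellerPay hv ⟨by positivity, hkx.trans hx.2⟩
      (hA.tile_subset_gridApprox hkn hj hcorner ⟨⟨?_, le_rfl⟩, hvj⟩)
    dsimp only
    gcongr
    linarith

lemma sum_le_two_of_le_increment {n : ℕ} (hn : 1 ≤ n) {G : ℝ → ℝ} {Δ : ℕ → ℝ}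
    (hG : ∀ x, G x ∈ Set.Icc (0:ℝ) 1)
    (h : ∀ k < n, Δ k ≤ G (((k : ℝ) + 1) / n) - G ((k : ℝ) / n) + 1 / n) :
    ∑ k ∈ Finset.range n, Δ k ≤ 2 := by
  have hn' : (n : ℝ) ≠ 0 := by positivity
  have htel := Finset.sum_range_sub (fun k : ℕ => G ((k : ℝ) / n)) n
  push_cast at htel
  calc ∑ k ∈ Finset.range n, Δ k
      ≤ ∑ k ∈ Finset.range n, (G (((k : ℝ) + 1) / n) - G ((k : ℝ) / n) + 1 / n) :=
        Finset.sum_le_sum fun k hk => h k (Finset.mem_range.1 hk)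
    _ = G ((n : ℝ) / n) - G (0 / n) + 1 := by
        rw [Finset.sum_add_distrib, htel, Finset.sum_const, Finset.card_range, nsmul_eq_mul,
          mul_one_div_cancel hn']
    _ ≤ 2 := by linarith [(hG ((n : ℝ) / n)).2, (hG (0 / n)).1]

/-- the per-column buyer-payment gaps and per-row seller-payment gaps
between a region and its grid approximation each sum to at most 2. -/
theorem payment_gap_sums (A : Set (ℝ × ℝ)) (hA : IsAllocRegion A)
    (n : ℕ) (hn : 1 ≤ n) :
    (∑ k ∈ Finset.range n,
        sSup ((fun v => buyerPay (gridApprox n A) v - buyerPay A v) ''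
          ((Set.Ioc ((k : ℝ) / n) (((k : ℝ) + 1) / n) ×ˢ Set.Icc (0:ℝ) 1)
            ∩ gridApprox n A)) ≤ 2) ∧
    (∑ j ∈ Finset.range n,
        sSup ((fun v => sellerPay A v - sellerPay (gridApprox n A) v) ''
          ((Set.Icc (0:ℝ) 1 ×ˢ Set.Ioc ((j : ℝ) / n) (((j : ℝ) + 1) / n))
            ∩ gridApprox n A)) ≤ 2) := by
  have hstep (k : ℕ) : (k : ℝ) / n ≤ ((k : ℝ) + 1) / n := by
    gcongr
    linarith
  have hε : (0:ℝ) ≤ 1 / n := by positivity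
  constructor
  · refine sum_le_two_of_le_increment hn (buyerThreshold_mem_Icc A) fun k hk => ?_
    have h0 : (0:ℝ) ≤ (k : ℝ) / n := by positivity
    refine Real.sSup_le ?_ (by linarith [hA.buyerThreshold_mono h0 (hstep k)])
    rintro _ ⟨v, ⟨⟨hvk, -⟩, hv⟩, rfl⟩
    linarith [hA.buyerPay_gridApprox_le hk hv (Ioc_subset_Icc_self hvk),
      hA.buyerThreshold_le_buyerPay (gridApprox_subset n A hv) h0 hvk.1.le]
  · refine sum_le_two_of_le_increment hn (sellerThreshold_mem_Icc A) fun j hj => ?_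
    have h1 : ((j : ℝ) + 1) / n ≤ 1 := by
      rw [div_le_one (by positivity)]
      exact_mod_cast hj
    refine Real.sSup_le ?_ (by linarith [hA.sellerThreshold_mono h1 (hstep j)])
    rintro _ ⟨v, ⟨⟨-, hvj⟩, hv⟩, rfl⟩
    linarith [hA.le_sellerPay_gridApprox hj hv (Ioc_subset_Icc_self hvj),
      hA.sellerPay_le_sellerThreshold (gridApprox_subset n A hv) h1 hvj.2]
end

section
/- Let A be a monotone allocation region, n ≥ 1 an integer, and ε = 1/n. Then at most 2n of the n^2 ε-tiles P satisfy both P ∩ A ≠ ∅ and P ⊄ A. Consequently, for every σ ∈ (0,1] and every σ-smooth Borel probability measure μ on [0,1]^2, μ(A \ φ_ε(A)) ≤ 2ε/σ. -/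
open MeasureTheory Set
open scoped Classical

/-- A tile of the unit grid is contained in the unit square. -/
lemma tile_subset_square {n k j : ℕ} (hn : 1 ≤ n) (hk : k < n) (hj : j < n) :
    tile n k j ⊆ square := by
  have hn0 : (0 : ℝ) < n := by exact_mod_cast hn
  have hk1 : (k : ℝ) + 1 ≤ n := by exact_mod_cast hk
  have hj1 : (j : ℝ) + 1 ≤ n := by exact_mod_cast hj
  have aux : ∀ m : ℕ, (m : ℝ) + 1 ≤ n →
      Icc ((m : ℝ) / n) (((m : ℝ) + 1) / n) ⊆ Icc (0 : ℝ) 1 := fun m hm =>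
    Icc_subset_Icc (by positivity) ((div_le_one hn0).2 hm)
  exact prod_mono (aux k hk1) (aux j hj1)

/-- The north-west corner of a tile lies in the tile. -/
lemma northWest_mem_tile (n k j : ℕ) :
    ((k : ℝ) / n, ((j : ℝ) + 1) / n) ∈ tile n k j := by
  have aux : ∀ m : ℕ, (m : ℝ) / n ≤ ((m : ℝ) + 1) / n := fun m => by gcongr; linarith
  exact ⟨⟨le_rfl, aux k⟩, ⟨aux j, le_rfl⟩⟩

/-- A monotone region that meets a tile contains its north-west corner. -/
lemma northWest_mem_of_inter_nonempty {A : Set (ℝ × ℝ)} (hA : IsAllocRegion A) {n k j : ℕ}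
    (hn : 1 ≤ n) (hk : k < n) (hj : j < n) (h : (tile n k j ∩ A).Nonempty) :
    ((k : ℝ) / n, ((j : ℝ) + 1) / n) ∈ A := by
  obtain ⟨x, hx, hxA⟩ := h
  exact hA.2.2 x hxA _ (tile_subset_square hn hk hj (northWest_mem_tile n k j))
    hx.1.1 hx.2.2

/-- A monotone region that contains a point south-east of a tile contains the tile. -/
lemma tile_subset_of_mem {A : Set (ℝ × ℝ)} (hA : IsAllocRegion A) {n k j : ℕ}
    (hn : 1 ≤ n) (hk : k < n) (hj : j < n) {x : ℝ × ℝ} (hx : x ∈ A)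
    (h1 : ((k : ℝ) + 1) / n ≤ x.1) (h2 : x.2 ≤ (j : ℝ) / n) : tile n k j ⊆ A :=
  fun y hy => hA.2.2 x hx y (tile_subset_square hn hk hj hy)
    (hy.1.2.trans h1) (h2.trans hy.2.1)

/-- The boundary tiles of `A`: those that meet `A` without being contained in it. -/
def boundaryTiles (n : ℕ) (A : Set (ℝ × ℝ)) : Set (Fin n × Fin n) :=
  {p | (tile n p.1 p.2 ∩ A).Nonempty ∧ ¬ tile n p.1 p.2 ⊆ A}

/-- Of two boundary tiles on the same antidiagonal, neither is strictly south-east of the other. -/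
lemma boundaryTiles_antidiagonal_le {A : Set (ℝ × ℝ)} (hA : IsAllocRegion A) {n : ℕ}
    (hn : 1 ≤ n) {p q : Fin n × Fin n} (hp : p ∈ boundaryTiles n A)
    (hq : q ∈ boundaryTiles n A) (h : (p.1 : ℕ) + p.2 = q.1 + q.2) :
    (q.1 : ℕ) ≤ p.1 := by
  by_contra! hlt
  have hc := northWest_mem_of_inter_nonempty hA hn q.1.2 q.2.2 hq.1
  have h1 : ((p.1 : ℕ) : ℝ) + 1 ≤ (q.1 : ℕ) := by exact_mod_cast hlt
  have h2 : ((q.2 : ℕ) : ℝ) + 1 ≤ (p.2 : ℕ) := by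
    have : (q.2 : ℕ) + 1 ≤ p.2 := by omega
    exact_mod_cast this
  refine hp.2 (tile_subset_of_mem hA hn p.1.2 p.2.2 hc ?_ ?_)
  · dsimp only; gcongr
  · dsimp only; gcongr

/-- Each antidiagonal of the grid contains at most one boundary tile. -/
lemma boundaryTiles_injOn {A : Set (ℝ × ℝ)} (hA : IsAllocRegion A) {n : ℕ} (hn : 1 ≤ n) :
    InjOn (fun p : Fin n × Fin n => (p.1 : ℕ) + p.2) (boundaryTiles n A) := by
  intro p hp q hq h
  dsimp only at h
  have h1 := boundaryTiles_antidiagonal_le hA hn hp hq h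
  have h2 := boundaryTiles_antidiagonal_le hA hn hq hp h.symm
  ext <;> omega

lemma ncard_boundaryTiles_le {A : Set (ℝ × ℝ)} (hA : IsAllocRegion A) {n : ℕ} (hn : 1 ≤ n) :
    (boundaryTiles n A).ncard ≤ 2 * n := by
  have h := ncard_le_ncard_of_injOn (t := (Finset.range (2 * n) : Set ℕ)) _
    (fun p _ => by simp only [Finset.coe_range, mem_Iio]; omega)
    (boundaryTiles_injOn hA hn) (Finset.finite_toSet _)
  rwa [ncard_coe_finset, Finset.card_range] at h

/-- Every point of the unit interval lies in a cell of the uniform grid. -/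
lemma exists_grid_cell {n : ℕ} (hn : 1 ≤ n) {x : ℝ} (hx : x ∈ Icc (0 : ℝ) 1) :
    ∃ k : Fin n, x ∈ Icc (((k : ℕ) : ℝ) / n) ((((k : ℕ) : ℝ) + 1) / n) := by
  have hn0 : (0 : ℝ) < n := by exact_mod_cast hn
  rcases hx.2.eq_or_lt with rfl | hx1
  · refine ⟨⟨n - 1, by omega⟩, ?_, ?_⟩
    · rw [div_le_one hn0]; exact_mod_cast Nat.sub_le n 1
    · rw [one_le_div hn0]
      have : n ≤ n - 1 + 1 := by omega
      exact_mod_cast this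
  · have hxn : 0 ≤ x * n := mul_nonneg hx.1 hn0.le
    refine ⟨⟨⌊x * n⌋₊, (Nat.floor_lt hxn).2 (by nlinarith)⟩, ?_, ?_⟩
    · rw [div_le_iff₀ hn0]; exact Nat.floor_le hxn
    · rw [le_div_iff₀ hn0]; exact (Nat.lt_floor_add_one _).le

/-- The part of `A` missed by its grid approximation is covered by the boundary tiles. -/
lemma diff_gridApprox_subset {A : Set (ℝ × ℝ)} (hA : IsAllocRegion A) {n : ℕ} (hn : 1 ≤ n) :
    A \ gridApprox n A ⊆ ⋃ p ∈ (boundaryTiles n A).toFinset, tile n p.1 p.2 := by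
  rintro x ⟨hxA, hx⟩
  obtain ⟨k, hk⟩ := exists_grid_cell hn (hA.2.1 hxA).1
  obtain ⟨j, hj⟩ := exists_grid_cell hn (hA.2.1 hxA).2
  have hxt : x ∈ tile n k j := ⟨hk, hj⟩
  refine mem_iUnion₂.2 ⟨(k, j), mem_toFinset.2 ⟨⟨x, hxt, hxA⟩, fun hsub => hx ?_⟩, hxt⟩
  simp only [gridApprox, mem_iUnion]
  exact ⟨k, j, hsub, hxt⟩

lemma volume_tile (n k j : ℕ) :
    volume (tile n k j) = ENNReal.ofReal (1 / (n : ℝ) * (1 / n)) := by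
  have aux : ∀ m : ℕ, ((m : ℝ) + 1) / n - m / n = 1 / n := fun m => by ring
  rw [tile, Measure.volume_eq_prod, Measure.prod_prod, Real.volume_Icc, Real.volume_Icc,
    aux, aux, ENNReal.ofReal_mul (by positivity)]

lemma measurableSet_gridApprox (n : ℕ) (A : Set (ℝ × ℝ)) : MeasurableSet (gridApprox n A) :=
  .iUnion fun _ => .iUnion fun _ => .iUnion fun _ => measurableSet_Icc.prod measurableSet_Icc

lemma volume_diff_gridApprox_le {A : Set (ℝ × ℝ)} (hA : IsAllocRegion A) {n : ℕ} (hn : 1 ≤ n) :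
    volume (A \ gridApprox n A) ≤ ENNReal.ofReal (2 * (1 / (n : ℝ))) := by
  have hn0 : (0 : ℝ) < n := by exact_mod_cast hn
  calc volume (A \ gridApprox n A)
      ≤ ∑ p ∈ (boundaryTiles n A).toFinset, volume (tile n p.1 p.2) :=
        (measure_mono (diff_gridApprox_subset hA hn)).trans (measure_biUnion_finset_le _ _)
    _ = ((boundaryTiles n A).ncard : ENNReal) * ENNReal.ofReal (1 / (n : ℝ) * (1 / n)) := by
        simp_rw [volume_tile]
        rw [Finset.sum_const, nsmul_eq_mul, ncard_eq_toFinset_card']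
    _ ≤ ((2 * n : ℕ) : ENNReal) * ENNReal.ofReal (1 / (n : ℝ) * (1 / n)) := by
        gcongr
        exact ncard_boundaryTiles_le hA hn
    _ = ENNReal.ofReal (2 * (1 / (n : ℝ))) := by
        rw [← ENNReal.ofReal_natCast, ← ENNReal.ofReal_mul (by positivity)]
        congr 1
        push_cast
        field_simp

/-- at most `2n` of the `n²` tiles intersect `A` without being contained
in it; consequently `μ(A \\ φ_ε(A)) ≤ 2ε/σ` for any σ-smooth measure `μ`. -/
theorem boundary_tiles (σ : ℝ) (hσ : σ ∈ Set.Ioc (0:ℝ) 1)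
    (μ : MeasureTheory.Measure (ℝ × ℝ)) [MeasureTheory.IsProbabilityMeasure μ]
    (hsupp : μ squareᶜ = 0)
    (hsmooth : ∀ E ⊆ square, MeasurableSet E →
      μ E ≤ MeasureTheory.volume E / ENNReal.ofReal σ)
    (A : Set (ℝ × ℝ)) (hA : IsAllocRegion A)
    (n : ℕ) (hn : 1 ≤ n) :
    Nat.card {p : Fin n × Fin n |
        (tile n p.1 p.2 ∩ A).Nonempty ∧ ¬ tile n p.1 p.2 ⊆ A} ≤ 2 * n ∧
    μ (A \ gridApprox n A) ≤ ENNReal.ofReal (2 * (1 / (n : ℝ)) / σ) := by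
  refine ⟨ncard_boundaryTiles_le hA hn, ?_⟩
  rw [ENNReal.ofReal_div_of_pos hσ.1]
  refine (hsmooth _ (sdiff_subset.trans hA.2.1)
    (hA.1.measurableSet.diff (measurableSet_gridApprox n A))).trans ?_
  gcongr
  exact volume_diff_gridApprox_le hA hn
end
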